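/- (Proposition 2.3, uniform bound on the growth rate.) For any k>0, every s>0 satisfying the fixed-point relation α(k,s)=−s² obeys s ≤ bg⟦ρ⟧/(4μ₋). -/

import Mathlib

open MeasureTheory Set

/-- Piecewise-constant coefficient on `(-b,1)`: value `vm` below the interface `{0}`,
value `vp` above. -/
noncomputable def pw (vm vp : ℝ) (x : ℝ) : ℝ := if x < 0 then vm else vp

/-- First derivative within `[-b,1]`. -/
noncomputable def d1 (b : ℝ) (ψ : ℝ → ℝ) : ℝ → ℝ := derivWithin ψ (Set.Icc (-b) 1)

/-- Second derivative within `[-b,1]`. -/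
noncomputable def d2 (b : ℝ) (ψ : ℝ → ℝ) : ℝ → ℝ := derivWithin (d1 b ψ) (Set.Icc (-b) 1)

/-- The viscous part `E1(ψ;k)` of the energy. -/
noncomputable def E1 (b μm μp k : ℝ) (ψ : ℝ → ℝ) : ℝ :=
  (1 / 2) * ∫ x in (-b)..1,
    pw μm μp x * (4 * k ^ 2 * d1 b ψ x ^ 2 + (k ^ 2 * ψ x + d2 b ψ x) ^ 2)

/-- The boundary part `E0(ψ;k)` of the energy. -/
noncomputable def E0 (b g ρm ρp σm σp k : ℝ) (ψ : ℝ → ℝ) : ℝ :=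
  k ^ 2 / 2 * (σp * k ^ 2 + g * ρp) * ψ 1 ^ 2
    + k ^ 2 / 2 * (σm * k ^ 2 - g * (ρp - ρm)) * ψ 0 ^ 2

/-- The total energy `E(ψ;k,s) = s E1(ψ;k) + E0(ψ;k)`. -/
noncomputable def En (b g ρm ρp μm μp σm σp k s : ℝ) (ψ : ℝ → ℝ) : ℝ :=
  s * E1 b μm μp k ψ + E0 b g ρm ρp σm σp k ψ

/-- The normalization functional `J(ψ;k)`. -/
noncomputable def Jen (b ρm ρp k : ℝ) (ψ : ℝ → ℝ) : ℝ :=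
  (1 / 2) * ∫ x in (-b)..1, pw ρm ρp x * (k ^ 2 * ψ x ^ 2 + d1 b ψ x ^ 2)

/-- The admissible class `𝒜`: `ψ : ℝ → ℝ` twice continuously differentiable on `[-b,1]`
with `ψ(-b) = ψ'(-b) = 0`. -/
def memA (b : ℝ) (ψ : ℝ → ℝ) : Prop :=
  ContDiffOn ℝ 2 ψ (Set.Icc (-b) 1) ∧ ψ (-b) = 0 ∧ d1 b ψ (-b) = 0

/-- The set of energy values over the constraint class `𝒞(k) = {ψ ∈ 𝒜 : J(ψ;k) = 1}`. -/
noncomputable def enSet (b g ρm ρp μm μp σm σp k s : ℝ) : Set ℝ :=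
  En b g ρm ρp μm μp σm σp k s '' {ψ : ℝ → ℝ | memA b ψ ∧ Jen b ρm ρp k ψ = 1}

/-- `α(k,s) := inf {E(ψ;k,s) : ψ ∈ 𝒞(k)}`. -/
noncomputable def alpha (b g ρm ρp μm μp σm σp k s : ℝ) : ℝ :=
  sInf (enSet b g ρm ρp μm μp σm σp k s)

theorem pw_intervalIntegrable (vm vp a c : ℝ) :
    IntervalIntegrable (pw vm vp) volume a c := by
  have h : ∀ v : ℝ, IntervalIntegrable (fun _ : ℝ => v) volume a c :=
    fun v => intervalIntegrable_const
  constructor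
  · exact Integrable.piecewise (s := Iio (0:ℝ)) measurableSet_Iio
      ((h vm).1.integrableOn) ((h vp).1.integrableOn)
  · exact Integrable.piecewise (s := Iio (0:ℝ)) measurableSet_Iio
      ((h vm).2.integrableOn) ((h vp).2.integrableOn)

theorem E1_lower (b μm μp k : ℝ) (ψ : ℝ → ℝ) (hb : 0 < b) (hμm : 0 < μm) (hμp : 0 < μp)
    (hψ : memA b ψ) : 2 * k ^ 2 * μm * (ψ 0 ^ 2 / b) ≤ E1 b μm μp k ψ := by
  obtain ⟨hC, h0, -⟩ := hψ
  have hu : UniqueDiffOn ℝ (Icc (-b) 1) := uniqueDiffOn_Icc (by linarith)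
  have hc0 : ContinuousOn ψ (Icc (-b) 1) := hC.continuousOn
  have hC1 : ContDiffOn ℝ 1 (d1 b ψ) (Icc (-b) 1) := hC.derivWithin hu (by norm_num)
  have hc1 : ContinuousOn (d1 b ψ) (Icc (-b) 1) := hC1.continuousOn
  have hc2 : ContinuousOn (d2 b ψ) (Icc (-b) 1) :=
    hC1.continuousOn_derivWithin hu (by norm_num)
  set G : ℝ → ℝ := fun x => 4 * k ^ 2 * d1 b ψ x ^ 2 + (k ^ 2 * ψ x + d2 b ψ x) ^ 2 with hG
  have hcG : ContinuousOn G (Icc (-b) 1) := by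
    simp only [hG]; fun_prop
  have hGnn : ∀ x, 0 ≤ G x := fun x => by simp only [hG]; positivity
  have hFi : IntervalIntegrable (fun x => pw μm μp x * G x) volume (-b) 1 :=
    (pw_intervalIntegrable μm μp (-b) 1).mul_continuousOn
      (by rwa [uIcc_of_le (by linarith)])
  have hF1 : IntervalIntegrable (fun x => pw μm μp x * G x) volume (-b) 0 :=
    hFi.mono_set (by
      rw [uIcc_of_le (by linarith), uIcc_of_le (by linarith)]
      exact Icc_subset_Icc le_rfl (by norm_num))
  have hF2 : IntervalIntegrable (fun x => pw μm μp x * G x) volume 0 1 :=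
    hFi.mono_set (by
      rw [uIcc_of_le (by linarith), uIcc_of_le (by linarith)]
      exact Icc_subset_Icc (by linarith) le_rfl)
  have hsplit := intervalIntegral.integral_add_adjacent_intervals hF1 hF2
  have hnn : 0 ≤ ∫ x in (0:ℝ)..1, pw μm μp x * G x := by
    apply intervalIntegral.integral_nonneg (by norm_num)
    intro x _
    refine mul_nonneg ?_ (hGnn x)
    unfold pw; split_ifs <;> linarith
  set c : ℝ := ψ 0 / b with hcdef
  have hsub : Icc (-b) 0 ⊆ Icc (-b) (1:ℝ) := Icc_subset_Icc le_rfl (by norm_num)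
  have hd1i : IntervalIntegrable (d1 b ψ) volume (-b) 0 :=
    (hc1.mono (by rwa [uIcc_of_le (by linarith)])).intervalIntegrable
  have hftc : ∫ x in (-b)..0, d1 b ψ x = ψ 0 := by
    rw [intervalIntegral.integral_eq_sub_of_hasDerivAt_of_le (by linarith) (hc0.mono hsub) _ hd1i,
      h0, sub_zero]
    intro x hx
    have hd : DifferentiableWithinAt ℝ ψ (Icc (-b) 1) x :=
      hC.differentiableOn (by norm_num) x ⟨hx.1.le, by linarith [hx.2]⟩
    exact hd.hasDerivWithinAt.hasDerivAt (Icc_mem_nhds hx.1 (by linarith [hx.2]))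
  have hLi : IntervalIntegrable (fun x => μm * (4 * k ^ 2) * (2 * c * d1 b ψ x - c ^ 2))
      volume (-b) 0 :=
    ((hd1i.const_mul _).sub intervalIntegrable_const).const_mul _
  have hle : ∫ x in (-b)..0, μm * (4 * k ^ 2) * (2 * c * d1 b ψ x - c ^ 2)
      ≤ ∫ x in (-b)..0, pw μm μp x * G x := by
    apply intervalIntegral.integral_mono_on_of_le_Ioo (by linarith) hLi hF1
    intro x hx
    have : pw μm μp x = μm := if_pos hx.2
    rw [this, mul_assoc]
    apply mul_le_mul_of_nonneg_left _ hμm.le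
    simp only [hG]
    nlinarith [mul_nonneg (sq_nonneg k) (sq_nonneg (d1 b ψ x - c)),
      sq_nonneg (k ^ 2 * ψ x + d2 b ψ x)]
  have hLv : ∫ x in (-b)..0, μm * (4 * k ^ 2) * (2 * c * d1 b ψ x - c ^ 2)
      = μm * (4 * k ^ 2) * (ψ 0 ^ 2 / b) := by
    rw [intervalIntegral.integral_const_mul,
      intervalIntegral.integral_sub (hd1i.const_mul _) intervalIntegrable_const,
      intervalIntegral.integral_const_mul, hftc, intervalIntegral.integral_const, hcdef]
    simp only [smul_eq_mul]
    field_simp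
    ring
  have : E1 b μm μp k ψ = 1 / 2 * ∫ x in (-b)..1, pw μm μp x * G x := rfl
  rw [this, ← hsplit]
  rw [hLv] at hle
  linarith

/-- Proposition 2.3, uniform bound on the growth rate: any `s > 0` with `α(k,s) = -s²`
satisfies `s ≤ b g ⟦ρ⟧ / (4 μ₋)`. -/
theorem growth_rate_uniform_bound
    (b g ρm ρp μm μp σm σp : ℝ)
    (hb : 0 < b) (hg : 0 < g) (hρm : 0 < ρm) (hρ : ρm < ρp)
    (hμm : 0 < μm) (hμp : 0 < μp) (hσm : 0 ≤ σm) (hσp : 0 ≤ σp) :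
    ∀ k : ℝ, 0 < k → ∀ s : ℝ, 0 < s →
      alpha b g ρm ρp μm μp σm σp k s = -(s ^ 2) →
      s ≤ b * g * (ρp - ρm) / (4 * μm) := by
  intro k hk s hs hα
  by_contra! hlt
  rw [div_lt_iff₀ (by positivity)] at hlt
  have h : 0 ≤ alpha b g ρm ρp μm μp σm σp k s := by
    apply Real.sInf_nonneg
    rintro _ ⟨ψ, ⟨hψ, -⟩, rfl⟩
    have h1 := mul_le_mul_of_nonneg_left (E1_lower b μm μp k ψ hb hμm hμp hψ) hs.le
    have hρp : 0 < ρp := hρm.trans hρ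
    have h2 : 0 ≤ k ^ 2 / 2 * (σp * k ^ 2 + g * ρp) * ψ 1 ^ 2 := by positivity
    have h3 : 0 ≤ k ^ 2 / 2 * (σm * k ^ 2) * ψ 0 ^ 2 := by positivity
    have h4 : 0 ≤ k ^ 2 / 2 * (ψ 0 ^ 2 / b) * (s * (4 * μm) - b * g * (ρp - ρm)) :=
      mul_nonneg (by positivity) (by linarith)
    have h5 : k ^ 2 / 2 * (ψ 0 ^ 2 / b) * (s * (4 * μm) - b * g * (ρp - ρm))
        = s * (2 * k ^ 2 * μm * (ψ 0 ^ 2 / b)) - k ^ 2 / 2 * (g * (ρp - ρm)) * ψ 0 ^ 2 := by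
      field_simp
      ring
    unfold En E0
    linarith
  have : 0 < s ^ 2 := by positivity
  linarith
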